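/- For every n ∈ ℕ, the polynomial y := Wr[H_1, H_2, H_n] ∈ ℝ[X] satisfies the bilinear exceptional Hermite differential equation ( η·y'' − 2η'·y' + η''·y ) − 2X·( η·y' − η'·y ) + 2(n−2)·η·y = 0 in ℝ[X], where η := Wr[H_1, H_2] = 4 + 8X². Equivalently, the exceptional Hermite polynomial Ĥ_n proportional to Wr[H_1,H_2,H_n] satisfies y'' − (2z + 8z/(1+2z²))·y' + 2n·y = 0. -/

import Mathlib

open Polynomial

/-- The physicists' Hermite polynomials: `H₀ = 1`, `H_{n+1} = 2·X·H_n − (H_n)'`. -/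
noncomputable def hermitePoly : ℕ → Polynomial ℝ
  | 0 => 1
  | n + 1 => 2 * X * hermitePoly n - derivative (hermitePoly n)

/-- The Wronskian of `m` polynomials: the determinant of the `m × m` matrix whose `(i, j)` entry
is the `j`-th derivative of `p i`. -/
noncomputable def polyWronskian {m : ℕ} (p : Fin m → Polynomial ℝ) : Polynomial ℝ :=
  Matrix.det (Matrix.of fun i j : Fin m => (⇑(derivative (R := ℝ)))^[(j : ℕ)] (p i))

/-- `H_{n+1}' = 2 (n + 1) H_n`. -/
theorem derivative_hermitePoly_succ (n : ℕ) :
    derivative (hermitePoly (n + 1)) = 2 * ((n : ℝ[X]) + 1) * hermitePoly n := by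
  induction n with
  | zero => simp [hermitePoly]
  | succ n ih =>
    rw [hermitePoly, derivative_sub, derivative_mul, ih]
    simp only [derivative_mul, derivative_add, derivative_X, derivative_natCast,
      derivative_ofNat, derivative_one]
    rw [show hermitePoly (n + 1) = 2 * X * hermitePoly n - derivative (hermitePoly n) from rfl]
    push_cast
    ring

/-- Hermite's differential equation `H_n'' = 2 X H_n' - 2 n H_n`. -/
theorem derivative_derivative_hermitePoly (n : ℕ) :
    derivative (derivative (hermitePoly n)) =
      2 * X * derivative (hermitePoly n) - 2 * (n : ℝ[X]) * hermitePoly n := by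
  have h := derivative_hermitePoly_succ n
  rw [hermitePoly, derivative_sub, derivative_mul, derivative_mul, derivative_X,
    derivative_ofNat] at h
  linear_combination -h

/-- The Wronskian of `H₁`, `H₂` and an arbitrary polynomial. -/
theorem polyWronskian_hermitePoly_one_two (p : ℝ[X]) :
    polyWronskian ![hermitePoly 1, hermitePoly 2, p] =
      (4 + 8 * X ^ 2) * derivative (derivative p) - 16 * X * derivative p + 16 * p := by
  simp [polyWronskian, Matrix.det_fin_three, hermitePoly]
  ring

/-- `y = Wr[H₁, H₂, H_n]` satisfies the bilinear exceptional Hermite equation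
`(η·y'' − 2η'·y' + η''·y) − 2X·(η·y' − η'·y) + 2(n−2)·η·y = 0`, where
`η = Wr[H₁, H₂] = 4 + 8X²`. -/
theorem exceptional_hermite_bilinear_ode (n : ℕ)
    (y : Polynomial ℝ) (hy : y = polyWronskian ![hermitePoly 1, hermitePoly 2, hermitePoly n])
    (η : Polynomial ℝ) (hη : η = 4 + 8 * X ^ 2) :
    (η * derivative (derivative y) - 2 * derivative η * derivative y
        + derivative (derivative η) * y)
      - 2 * X * (η * derivative y - derivative η * y)
      + C (2 * ((n : ℝ) - 2)) * η * y = 0 := by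
  rw [polyWronskian_hermitePoly_one_two, derivative_derivative_hermitePoly] at hy
  have h2 : (C 2 : ℝ[X]) = 2 := rfl
  have hC : C (2 * ((n : ℝ) - 2)) = 2 * ((n : ℝ[X]) - 2) := by simp [h2]
  subst hy hη
  rw [hC]
  simp only [derivative_mul, derivative_add, derivative_sub, derivative_X, derivative_X_pow,
    derivative_natCast, derivative_ofNat, derivative_derivative_hermitePoly, h2,
    derivative_one, derivative_zero, Nat.add_one_sub_one, Nat.cast_ofNat, pow_one]
  ring
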